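/- arXiv:2601.18349 — 3 statements merged into one kernel-verified Lean document; each statement's English description precedes it below -/
import Mathlib

section
/- Let d ≥ 1, let A be a d×d matrix over ℚ̄, let x ∈ ℚ̄^d, and let L ≥ 1 be an integer. Then there exist a natural number μ and an invertible d×d matrix M over ℚ̄ such that for every r with 0 ≤ r ≤ L−1: (i) A^{Ln}·(A^{d+r}x) = M^n·(A^{d+r}x) for all n ∈ ℕ (so the orbit of A^{d+r}x under A^L coincides with its orbit under M); and (ii) for every n ∈ ℕ, the dimension of the ℚ̄-linear span of { A^{Lm}·(A^{Ln+d+r}x) : m ∈ ℕ } equals μ. -/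
open Matrix

noncomputable section

/-- `ℚ̄`, a fixed algebraic closure of `ℚ`. -/
abbrev Qbar : Type := AlgebraicClosure ℚ

namespace Matrix

variable {K n : Type*} [Field K] [Fintype n] [DecidableEq n]

lemma mulVec_pow_card_eq_zero_of_mulVec_eq_zero (A : Matrix n n K) (v : n → K)
    (h : A *ᵥ (A ^ Fintype.card n *ᵥ v) = 0) : A ^ Fintype.card n *ᵥ v = 0 := by
  have hker := Module.End.ker_pow_le_ker_pow_finrank (toLin' A) (Fintype.card n + 1)
  rw [Module.finrank_pi, ← toLin'_pow, ← toLin'_pow] at hker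
  have hv : v ∈ LinearMap.ker (toLin' (A ^ (Fintype.card n + 1))) := by
    rw [LinearMap.mem_ker, toLin'_apply, pow_succ', ← mulVec_mulVec, h]
  simpa only [LinearMap.mem_ker, toLin'_apply] using hker hv

/-- On the range of `A ^ card n`, a square matrix `A` acts as some invertible matrix. -/
lemma exists_isUnit_pow_mulVec_eq (A : Matrix n n K) :
    ∃ N : Matrix n n K, IsUnit N ∧ ∀ (k : ℕ) (v : n → K),
      A ^ k *ᵥ (A ^ Fintype.card n *ᵥ v) = N ^ k *ᵥ (A ^ Fintype.card n *ᵥ v) := by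
  let W : Submodule K (n → K) := LinearMap.range (toLin' (A ^ Fintype.card n))
  let f : W →ₗ[K] (n → K) := toLin' A ∘ₗ W.subtype
  have hf : Function.Injective f := by
    refine (injective_iff_map_eq_zero f).2 ?_
    rintro ⟨_, v, rfl⟩ h
    exact Subtype.ext (A.mulVec_pow_card_eq_zero_of_mulVec_eq_zero v
      (by simpa only [f, LinearMap.comp_apply, Submodule.subtype_apply, toLin'_apply] using h))
  obtain ⟨g, hg⟩ := Submodule.exists_linearEquiv_restrict_eq (LinearEquiv.ofInjective f hf)
  have hN : ∀ v, LinearMap.toMatrix' (g : (n → K) →ₗ[K] (n → K)) *ᵥ v = g v := fun v ↦ by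
    rw [← toLin'_apply, toLin'_toMatrix', LinearEquiv.coe_coe]
  have hA : ∀ v, A *ᵥ (A ^ Fintype.card n *ᵥ v) = g (A ^ Fintype.card n *ᵥ v) := fun v ↦
    hg ⟨_, v, rfl⟩
  refine ⟨LinearMap.toMatrix' g, mulVec_injective_iff_isUnit.1 fun v w h ↦ ?_, fun k ↦ ?_⟩
  · exact g.injective (by simpa only [hN] using h)
  · induction k with
    | zero => simp
    | succ k ih =>
      intro v
      have hcomm : A *ᵥ (A ^ Fintype.card n *ᵥ v) = A ^ Fintype.card n *ᵥ (A *ᵥ v) := by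
        rw [mulVec_mulVec, mulVec_mulVec, ← pow_succ, ← pow_succ']
      rw [pow_succ, ← mulVec_mulVec, hcomm, ih, ← hcomm, hA, ← hN, mulVec_mulVec, ← pow_succ]

lemma finrank_span_mulVec_image {N : Matrix n n K} (hN : IsUnit N) (s : Set (n → K)) :
    Module.finrank K (Submodule.span K ((N *ᵥ ·) '' s)) =
      Module.finrank K (Submodule.span K s) := by
  have hmap : Submodule.span K ((N *ᵥ ·) '' s) = (Submodule.span K s).map (toLin' N) := by
    rw [Submodule.map_span]
    rfl
  rw [hmap]
  exact (Submodule.equivMapOfInjective (toLin' N)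
    (mulVec_injective_iff_isUnit.2 hN) _).finrank_eq.symm

end Matrix

/-- For any `d ≥ 1`, matrix `A` over `ℚ̄`, vector `x`, and `L ≥ 1`, there are
`μ : ℕ` and an invertible matrix `M` such that for all `0 ≤ r ≤ L - 1`:
(i) the orbit of `A^(d+r) x` under `A^L` coincides (pointwise) with its orbit under `M`; and
(ii) every tail of that orbit spans a subspace of dimension `μ`. -/
theorem stable_dimension_reduction (d : ℕ) (hd : 1 ≤ d)
    (A : Matrix (Fin d) (Fin d) Qbar) (x : Fin d → Qbar) (L : ℕ) (hL : 1 ≤ L) :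
    ∃ (μ : ℕ) (M : Matrix (Fin d) (Fin d) Qbar), IsUnit M ∧
      ∀ r : ℕ, r ≤ L - 1 →
        ((∀ n : ℕ, (A ^ (L * n)) *ᵥ ((A ^ (d + r)) *ᵥ x) = (M ^ n) *ᵥ ((A ^ (d + r)) *ᵥ x)) ∧
          (∀ n : ℕ, Module.finrank Qbar
              ↥(Submodule.span Qbar
                {y : Fin d → Qbar | ∃ m : ℕ, y = (A ^ (L * m)) *ᵥ ((A ^ (L * n + d + r)) *ᵥ x)})
            = μ)) := by
  obtain ⟨N, hN, hAN⟩ := A.exists_isUnit_pow_mulVec_eq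
  rw [Fintype.card_fin] at hAN
  have hshift : ∀ k j : ℕ, A ^ k *ᵥ (A ^ (d + j) *ᵥ x) = N ^ k *ᵥ (A ^ (d + j) *ᵥ x) := by
    intro k j
    rw [pow_add A d j, ← mulVec_mulVec x (A ^ d) (A ^ j), hAN]
  refine ⟨Module.finrank Qbar (Submodule.span Qbar
    (Set.range fun m : ℕ ↦ A ^ (L * m) *ᵥ (A ^ d *ᵥ x))), N ^ L, hN.pow L, fun r _ ↦ ⟨fun n ↦ ?_,
      fun n ↦ ?_⟩⟩
  · rw [← pow_mul, hshift]
  · rw [← finrank_span_mulVec_image (hN.pow (L * n + r)) (Set.range _), ← Set.range_comp]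
    have hm : ∀ m : ℕ, N ^ (L * n + r) *ᵥ (A ^ (L * m) *ᵥ (A ^ d *ᵥ x)) =
        A ^ (L * m) *ᵥ (A ^ (L * n + d + r) *ᵥ x) := by
      intro m
      rw [mulVec_mulVec x, ← pow_add, add_comm (L * m) d, ← hshift]
      simp only [mulVec_mulVec, ← pow_add]
      congr 2
      ring
    have hset : {y : Fin d → Qbar | ∃ m : ℕ, y = A ^ (L * m) *ᵥ (A ^ (L * n + d + r) *ᵥ x)} =
        Set.range ((N ^ (L * n + r) *ᵥ ·) ∘ fun m : ℕ ↦ A ^ (L * m) *ᵥ (A ^ d *ᵥ x)) := by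
      ext y
      exact exists_congr fun m ↦ by rw [Function.comp_apply, hm, eq_comm]
    rw [hset]

end
end

section
/- Let K be a number field and let λ₁,…,λ_s ∈ K (s ≥ 2) be distinct and nonzero, with λ_i/λ_j not a root of unity whenever i ≠ j. Let m₁,…,m_s ≥ 1 be integers and d = m₁ + ⋯ + m_s. Let t be an integer with 0 < t ≤ d and d < 2t + 2 − ⌊(t+1)/2⌋. Then at least one of the following holds: (a) there exists an Archimedean absolute value |·|_v on K with Σ_{i : λ_i is v-dominant} m_i ≤ t; or (b) there exists a non-Archimedean absolute value |·|_v on K with Σ_{i : λ_i is v-dominant} m_i ≤ ⌊(t+1)/2⌋ + d − (t+1). Here λ_i is called v-dominant if |λ_i|_v ≥ |λ_j|_v for all 1 ≤ j ≤ s. -/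
open scoped Classical

noncomputable section

/-- An absolute value is non-Archimedean if it satisfies the ultrametric inequality. -/
def IsNonarch {K : Type} [Field K] (v : AbsoluteValue K ℝ) : Prop :=
  ∀ x y : K, v (x + y) ≤ max (v x) (v y)

/-- The absolute value on a field induced by a complex embedding is not ultrametric. -/
theorem not_isNonarch_place {K : Type} [Field K] (φ : K →+* ℂ) :
    ¬ IsNonarch (NumberField.place φ) := by
  intro h
  have h2 := h 1 1
  rw [one_add_one_eq_two, NumberField.place_apply, map_ofNat] at h2
  norm_num at h2

/-- A nonzero element of a number field that is bounded by one at every ultrametric absolute value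
and under every complex embedding is a root of unity. -/
theorem exists_pow_eq_one_of_forall_le_one {L : Type} [Field L] [NumberField L] {x : L}
    (hx : x ≠ 0) (hna : ∀ w : AbsoluteValue L ℝ, IsNonarch w → w x ≤ 1)
    (ha : ∀ φ : L →+* ℂ, ‖φ x‖ ≤ 1) : ∃ n : ℕ, 1 ≤ n ∧ x ^ n = 1 := by
  have hint : IsIntegral ℤ x := by
    obtain ⟨y, rfl⟩ := IsDedekindDomain.HeightOneSpectrum.mem_integers_of_valuation_le_one
      (R := NumberField.RingOfIntegers L) L x fun P => by
        have h := hna (NumberField.HeightOneSpectrum.adicAbv L P)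
          (NumberField.HeightOneSpectrum.isNonarchimedean_adicAbv L P)
        rw [NumberField.HeightOneSpectrum.adicAbv_def] at h
        exact (WithZeroMulInt.toNNReal_le_one_iff
          (NumberField.HeightOneSpectrum.one_lt_absNorm_nnreal P)).mp (mod_cast h)
    exact y.isIntegral_coe
  obtain ⟨n, hn, h⟩ := NumberField.Embeddings.pow_eq_one_of_norm_le_one L ℂ hx hint ha
  exact ⟨n, hn, h⟩

/-- Three subsets whose total weight exceeds twice the weight of the whole type share a point. -/
theorem exists_mem_of_two_mul_sum_lt {ι : Type*} [Fintype ι] (m : ι → ℕ) (A B C : Finset ι)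
    (h : 2 * ∑ i, m i < ∑ i ∈ A, m i + ∑ i ∈ B, m i + ∑ i ∈ C, m i) :
    ∃ i, i ∈ A ∧ i ∈ B ∧ i ∈ C := by
  by_contra! hne
  refine h.not_ge ?_
  have hsum (S : Finset ι) : ∑ i ∈ S, m i = ∑ i, if i ∈ S then m i else 0 := by simp
  rw [hsum A, hsum B, hsum C, Finset.mul_sum, ← Finset.sum_add_distrib,
    ← Finset.sum_add_distrib]
  refine Finset.sum_le_sum fun i _ => ?_
  have := hne i
  split_ifs <;> first | omega | tauto

/-- If `a * b = c * d` and `w b ≤ w d`, then `w c ≤ w a`. -/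
theorem AbsoluteValue.le_of_mul_eq_mul {L : Type*} [Field L] (w : AbsoluteValue L ℝ)
    {a b c d : L} (h : a * b = c * d) (hd : d ≠ 0) (hbd : w b ≤ w d) : w c ≤ w a := by
  have hw : w a * w b = w c * w d := by rw [← map_mul, h, map_mul]
  refine le_of_mul_le_mul_right ?_ (w.pos hd)
  rw [← hw]
  exact mul_le_mul_of_nonneg_left hbd (w.nonneg a)

/-- Every complex embedding of a number field and its conjugate factor through a common number
field. -/
theorem exists_numberField_factor_conj {K : Type} [Field K] [NumberField K] (σ : K →+* ℂ) :
    ∃ (L : Type) (_ : Field L) (_ : NumberField L) (ι : L →+* ℂ) (f g : K →+* L),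
      ∀ x, ι (f x) = σ x ∧ ι (g x) = starRingEnd ℂ (σ x) := by
  let L := IntermediateField.normalClosure ℚ K ℂ
  have : NumberField L := { to_charZero := inferInstance, to_finiteDimensional := inferInstance }
  let e := normalClosure.algHomEquiv ℚ K ℂ
  exact ⟨L, inferInstance, this, L.val.toRingHom, (e.symm σ.toRatAlgHom).toRingHom,
    (e.symm ((starRingEnd ℂ).comp σ).toRatAlgHom).toRingHom, fun x => ⟨rfl, rfl⟩⟩

/-- Let `K` be a number field, `λ₁, …, λ_s ∈ K` distinct nonzero with no
ratio of distinct ones a root of unity, weights `m i ≥ 1` of total `d`, and `0 < t ≤ d` with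
`d < 2t + 2 - ⌊(t+1)/2⌋`.  Then there is an Archimedean absolute value with dominant weight at
most `t`, or a non-Archimedean absolute value with dominant weight at most
`⌊(t+1)/2⌋ + d - (t+1)`. -/
theorem dominant_terms_dichotomy (K : Type) [Field K] [NumberField K]
    (s : ℕ) (hs : 2 ≤ s) (lam : Fin s → K)
    (hinj : Function.Injective lam) (h0 : ∀ i, lam i ≠ 0)
    (hnd : ∀ i j, i ≠ j → ∀ n : ℕ, 1 ≤ n → (lam i / lam j) ^ n ≠ 1)
    (m : Fin s → ℕ) (hm : ∀ i, 1 ≤ m i)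
    (d t : ℕ) (hd : d = ∑ i, m i) (ht0 : 0 < t) (htd : t ≤ d)
    (hdt : d < 2 * t + 2 - (t + 1) / 2) :
    (∃ v : AbsoluteValue K ℝ, ¬ IsNonarch v ∧
        ∑ i ∈ Finset.univ.filter
            (fun i : Fin s => ∀ j : Fin s, v (lam j) ≤ v (lam i)), m i ≤ t) ∨
    (∃ v : AbsoluteValue K ℝ, IsNonarch v ∧
        ∑ i ∈ Finset.univ.filter
            (fun i : Fin s => ∀ j : Fin s, v (lam j) ≤ v (lam i)), m i
          ≤ (t + 1) / 2 + d - (t + 1)) := by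
  by_contra! hcon
  obtain ⟨harch, hnonarch⟩ := hcon
  let dom (v : AbsoluteValue K ℝ) : Finset (Fin s) :=
    Finset.univ.filter fun i : Fin s => ∀ j : Fin s, v (lam j) ≤ v (lam i)
  have mem_dom (v : AbsoluteValue K ℝ) (i : Fin s) :
      i ∈ dom v ↔ ∀ j, v (lam j) ≤ v (lam i) := by simp [dom]
  have hweight (v : AbsoluteValue K ℝ) : d ≤ ∑ i ∈ dom v, m i + t / 2 := by
    by_cases hv : IsNonarch v
    · have : _ < ∑ i ∈ dom v, m i := hnonarch v hv
      omega
    · have : _ < ∑ i ∈ dom v, m i := harch v hv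
      omega
  obtain ⟨σ⟩ : Nonempty (K →+* ℂ) := inferInstance
  obtain ⟨L, _, _, ι, f, g, hfg⟩ := exists_numberField_factor_conj σ
  have hD : t < ∑ i ∈ dom (NumberField.place σ), m i := harch _ (not_isNonarch_place σ)
  have hcomm {i k : Fin s} (hi : i ∈ dom (NumberField.place σ))
      (hk : k ∈ dom (NumberField.place σ)) :
      f (lam k) * g (lam k) = f (lam i) * g (lam i) := by
    apply ι.injective
    have h : ‖σ (lam k)‖ = ‖σ (lam i)‖ :=
      le_antisymm ((mem_dom _ i).mp hi k) ((mem_dom _ k).mp hk i)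
    simp only [map_mul, hfg, Complex.mul_conj', h]
  have hall (w : AbsoluteValue L ℝ) {k : Fin s} (hk : k ∈ dom (NumberField.place σ)) (j : Fin s) :
      w (f (lam j)) ≤ w (f (lam k)) := by
    obtain ⟨i, hi, hif, hig⟩ := exists_mem_of_two_mul_sum_lt m (dom (NumberField.place σ))
      (dom (w.comp f.injective)) (dom (w.comp g.injective)) (by
        have := hweight (w.comp f.injective)
        have := hweight (w.comp g.injective)
        omega)
    exact ((mem_dom _ i).mp hif j).trans <| w.le_of_mul_eq_mul (hcomm hi hk)
      ((map_ne_zero g).mpr (h0 i)) ((mem_dom _ i).mp hig k)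
  obtain ⟨k, hk⟩ : (dom (NumberField.place σ)).Nonempty :=
    Finset.nonempty_of_sum_ne_zero (Nat.ne_zero_of_lt hD)
  have : Nontrivial (Fin s) := Fin.nontrivial_iff_two_le.mpr hs
  obtain ⟨j, hjk⟩ := exists_ne k
  have hle (w : AbsoluteValue L ℝ) : w (f (lam j / lam k)) ≤ 1 := by
    rw [map_div₀, map_div₀]
    exact div_le_one_of_le₀ (hall w hk j) (w.nonneg _)
  obtain ⟨n, hn, h⟩ := exists_pow_eq_one_of_forall_le_one
    ((map_ne_zero f).mpr (div_ne_zero (h0 j) (h0 k))) (fun w _ => hle w)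
    (fun φ => hle (NumberField.place φ))
  exact hnd j k hjk n hn (f.injective (by rw [map_pow, h, map_one]))

end
end

section
/- Let μ₁,…,μ_s ∈ ℚ̄ be nonzero and multiplicatively independent, and let P ∈ ℚ̄[x₀,x₁,…,x_s] be a nonzero polynomial. Then there exists a natural number B (depending only on P and s) such that for every integer ℓ ≥ 1 the following holds. Set k = ℓ^{s+1} and let Q₁,…,Q_k enumerate the monomials x₀^{m₀}x₁^{m₁}⋯x_s^{m_s} with 0 ≤ m_i ≤ ℓ−1 for all i. Define sequences w⁽ʲ⁾_n = Q_j(n+1, μ₁^n, …, μ_s^n)·P(n+1, μ₁^n, …, μ_s^n) for 1 ≤ j ≤ k. Then: (i) w⁽¹⁾,…,w⁽ᵏ⁾ are linearly independent over ℚ̄; (ii) there is a single linear recurrence of order at most ℓ^{s+1} + B·ℓ^s satisfied by all of w⁽¹⁾,…,w⁽ᵏ⁾; (iii) each w⁽ʲ⁾ is a non-degenerate LRS; and (iv) the set {n ∈ ℕ : w⁽ʲ⁾_n = 0 for all 1 ≤ j ≤ k} equals {n ∈ ℕ : P(n+1, μ₁^n, …, μ_s^n) = 0}. -/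
noncomputable section

/-- The point `(n + 1, μ₁^n, …, μ_s^n)`. -/
def expPoint {K : Type*} [Field K] {s : ℕ} (μ : Fin s → K) (n : ℕ) : Fin (s + 1) → K :=
  Fin.cons ((n : K) + 1) (fun i => μ i ^ n)

/-- The left shift on sequences. -/
def seqShift (K : Type*) [Field K] : Module.End K (ℕ → K) :=
  LinearMap.funLeft K K (· + 1)

section Shift

variable {K : Type*} [Field K]

theorem seqShift_pow_apply (k : ℕ) (w : ℕ → K) (n : ℕ) :
    (seqShift K ^ k) w n = w (n + k) := by
  induction k generalizing n with
  | zero => simp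
  | succ k ih =>
    rw [pow_succ', Module.End.mul_apply]
    change (seqShift K ^ k) w (n + 1) = _
    rw [ih, add_right_comm, add_assoc]

theorem aeval_seqShift_apply (q : Polynomial K) (w : ℕ → K) (n : ℕ) :
    Polynomial.aeval (seqShift K) q w n =
      ∑ i ∈ Finset.range (q.natDegree + 1), q.coeff i * w (n + i) := by
  simp [Polynomial.aeval_eq_sum_range, LinearMap.sum_apply, Finset.sum_apply, seqShift_pow_apply]

/-- A sequence killed by a monic polynomial in the shift satisfies the associated recurrence. -/
theorem recurrence_of_aeval_seqShift_eq_zero {q : Polynomial K} (hq : q.Monic) {w : ℕ → K}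
    (hw : Polynomial.aeval (seqShift K) q w = 0) (n : ℕ) :
    w (n + q.natDegree) = ∑ i : Fin q.natDegree,
      -q.coeff (q.natDegree - 1 - i) * w (n + q.natDegree - 1 - i) := by
  have h := congrFun hw n
  rw [aeval_seqShift_apply, Finset.sum_range_succ, hq.coeff_natDegree, one_mul, Pi.zero_apply,
    ← Finset.sum_range_reflect] at h
  rw [eq_neg_of_add_eq_zero_right h,
    Fin.sum_univ_eq_sum_range (fun i => -q.coeff (q.natDegree - 1 - i) *
      w (n + q.natDegree - 1 - i)), ← Finset.sum_neg_distrib]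
  refine Finset.sum_congr rfl fun i hi => ?_
  rw [Finset.mem_range] at hi
  rw [show n + q.natDegree - 1 - i = n + (q.natDegree - 1 - i) by omega, neg_mul]

theorem seqShift_sub_smul_pow_apply (c : K) (g : K → K) (N : ℕ) :
    ((seqShift K - c • 1) ^ N) (fun n : ℕ => g n * c ^ n) =
      fun n : ℕ => ((fwdDiff 1)^[N] g) n * c ^ (n + N) := by
  induction N with
  | zero => simp
  | succ N ih =>
    rw [pow_succ', Module.End.mul_apply, ih]
    funext n
    rw [Function.iterate_succ_apply', fwdDiff]
    simp only [seqShift, LinearMap.sub_apply, LinearMap.smul_apply, Module.End.one_apply,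
      Pi.sub_apply, Pi.smul_apply, LinearMap.funLeft_apply, smul_eq_mul, Nat.cast_add,
      Nat.cast_one]
    ring

theorem polynomial_mul_pow_mem_ker (R : Polynomial K) (c : K) {N : ℕ} (h : R.natDegree < N) :
    ((seqShift K - c • 1) ^ N) (fun n : ℕ => R.eval (n : K) * c ^ n) = 0 := by
  rw [seqShift_sub_smul_pow_apply c (fun x => R.eval x),
    Polynomial.fwdDiff_iter_eq_zero_of_degree_lt h]
  funext n
  simp

/-- Exponential polynomials with distinct nonzero bases vanish only trivially. -/
theorem polynomial_eq_zero_of_sum_mul_pow_eq_zero [CharZero K] {ι : Type*} (S : Finset ι)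
    (ν : ι → K) (hν : Set.InjOn ν S) (hν0 : ∀ i ∈ S, ν i ≠ 0) (R : ι → Polynomial K)
    (h : ∀ n : ℕ, ∑ i ∈ S, (R i).eval (n : K) * ν i ^ n = 0) : ∀ i ∈ S, R i = 0 := by
  classical
  have hind : iSupIndep fun i : S => (seqShift K).maxGenEigenspace (ν i) :=
    (Module.End.independent_maxGenEigenspace (seqShift K)).comp
      (f := fun i : S => ν i) hν.injective
  rw [iSupIndep_iff_finsetSum_eq_zero_imp_eq_zero] at hind
  intro i hi
  have hz := hind Finset.univ (fun j n => (R j).eval (n : K) * ν j ^ n)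
    (fun j _ => (Module.End.mem_maxGenEigenspace _ _ _).2
      ⟨_, polynomial_mul_pow_mem_ker (R j) (ν j) (Nat.lt_succ_self _)⟩)
    (by
      funext n
      rw [Finset.sum_apply, Finset.univ_eq_attach, Pi.zero_apply, ← h n]
      exact Finset.sum_attach S (fun j => (R j).eval (n : K) * ν j ^ n))
    ⟨i, hi⟩ (Finset.mem_univ _)
  refine Polynomial.eq_zero_of_infinite_isRoot _
    ((Set.infinite_range_of_injective (Nat.cast_injective (R := K))).mono ?_)
  rintro _ ⟨n, rfl⟩
  exact (mul_eq_zero.1 (congrFun hz n)).resolve_right (pow_ne_zero _ (hν0 i hi))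

end Shift

section ExpPoint

variable {K : Type*} [Field K] {s : ℕ}

/-- The coefficient of `∏ i, μ i ^ (n * m i)` in the sequence `n ↦ F (n + 1, μ₁^n, …, μ_s^n)`,
as a polynomial in `n`. -/
def tailCoeff (F : MvPolynomial (Fin (s + 1)) K) (m : Fin s →₀ ℕ) : Polynomial K :=
  ∑ d ∈ F.support with d.tail = m,
    Polynomial.C (F.coeff d) * (Polynomial.X + Polynomial.C 1) ^ d 0

/-- The exponents of `μ` occurring in the sequence `n ↦ F (n + 1, μ₁^n, …, μ_s^n)`. -/
def tailSupport (F : MvPolynomial (Fin (s + 1)) K) : Finset (Fin s →₀ ℕ) :=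
  F.support.image Finsupp.tail

theorem tailCoeff_ne_zero {F : MvPolynomial (Fin (s + 1)) K} {d : Fin (s + 1) →₀ ℕ}
    (hd : d ∈ F.support) : tailCoeff F d.tail ≠ 0 := by
  intro h
  have h' := congrArg (fun p : Polynomial K =>
    (p.comp (Polynomial.X - Polynomial.C 1)).coeff (d 0)) h
  simp only [tailCoeff, Polynomial.sum_comp, Polynomial.mul_comp, Polynomial.C_comp,
    Polynomial.pow_comp, Polynomial.add_comp, Polynomial.X_comp, sub_add_cancel,
    Polynomial.finsetSum_coeff, Polynomial.coeff_C_mul_X_pow, Polynomial.zero_comp,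
    Polynomial.coeff_zero] at h'
  rw [Finset.sum_eq_single d] at h'
  · simp only [if_true] at h'
    exact MvPolynomial.mem_support_iff.1 hd h'
  · intro d' hd' hne
    refine if_neg fun h0 => hne ?_
    rw [← Finsupp.cons_tail d', ← Finsupp.cons_tail d, (Finset.mem_filter.1 hd').2, h0]
  · intro h1
    exact (h1 (Finset.mem_filter.2 ⟨hd, rfl⟩)).elim

theorem eval_expPoint (μ : Fin s → K) (F : MvPolynomial (Fin (s + 1)) K) (n : ℕ) :
    MvPolynomial.eval (expPoint μ n) F =
      ∑ d ∈ F.support, F.coeff d * (((n : K) + 1) ^ d 0 * (∏ i, μ i ^ d.tail i) ^ n) := by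
  rw [MvPolynomial.eval_eq']
  refine Finset.sum_congr rfl fun d _ => ?_
  simp only [Fin.prod_univ_succ, expPoint, Fin.cons_zero, Fin.cons_succ, Finsupp.tail_apply,
    ← Finset.prod_pow, ← pow_mul, mul_comm n]

theorem eval_expPoint_eq_sum_tailSupport (μ : Fin s → K) (F : MvPolynomial (Fin (s + 1)) K)
    (n : ℕ) : MvPolynomial.eval (expPoint μ n) F =
      ∑ m ∈ tailSupport F, (tailCoeff F m).eval (n : K) * (∏ i, μ i ^ m i) ^ n := by
  rw [eval_expPoint, tailSupport, ← Finset.sum_fiberwise_of_maps_to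
    (fun d hd => Finset.mem_image_of_mem Finsupp.tail hd)]
  refine Finset.sum_congr rfl fun m _ => ?_
  rw [tailCoeff, Polynomial.eval_finsetSum, Finset.sum_mul]
  refine Finset.sum_congr rfl fun d hd => ?_
  rw [(Finset.mem_filter.1 hd).2]
  simp [mul_assoc]

theorem div_prod_pow_pow_ne_one {μ : Fin s → K} (hμ : ∀ i, μ i ≠ 0)
    (hmulind : ∀ t : Fin s → ℤ, (∏ i, μ i ^ t i) = 1 → t = 0) {m m' : Fin s →₀ ℕ}
    (hne : m ≠ m') {N : ℕ} (hN : 1 ≤ N) :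
    ((∏ i, μ i ^ m i) / ∏ i, μ i ^ m' i) ^ N ≠ 1 := by
  intro h
  have h0 := hmulind (fun i => ((m i : ℤ) - m' i) * N) (by
    rw [← h, ← Finset.prod_div_distrib, ← Finset.prod_pow]
    refine Finset.prod_congr rfl fun i _ => ?_
    rw [zpow_mul, zpow_sub₀ (hμ i)]
    simp)
  refine hne (Finsupp.ext fun i => ?_)
  have := congrFun h0 i
  simp only [Pi.zero_apply, mul_eq_zero] at this
  omega

theorem prod_pow_injective {μ : Fin s → K} (hμ : ∀ i, μ i ≠ 0)
    (hmulind : ∀ t : Fin s → ℤ, (∏ i, μ i ^ t i) = 1 → t = 0) :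
    Function.Injective fun m : Fin s →₀ ℕ => ∏ i, μ i ^ m i := by
  intro m m' h
  by_contra hne
  refine div_prod_pow_pow_ne_one hμ hmulind hne le_rfl ?_
  rw [pow_one]
  exact (div_eq_one_iff_eq (Finset.prod_ne_zero_iff.2 fun i _ => pow_ne_zero _ (hμ i))).2 h

/-- A polynomial vanishing at all points `(n + 1, μ₁^n, …, μ_s^n)` is zero. -/
theorem eq_zero_of_forall_eval_expPoint_eq_zero [CharZero K] {μ : Fin s → K}
    (hμ : ∀ i, μ i ≠ 0) (hmulind : ∀ t : Fin s → ℤ, (∏ i, μ i ^ t i) = 1 → t = 0)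
    {F : MvPolynomial (Fin (s + 1)) K}
    (h : ∀ n : ℕ, MvPolynomial.eval (expPoint μ n) F = 0) : F = 0 := by
  by_contra hF
  obtain ⟨d, hd⟩ := Finset.nonempty_iff_ne_empty.2 (mt MvPolynomial.support_eq_empty.1 hF)
  exact tailCoeff_ne_zero hd <| polynomial_eq_zero_of_sum_mul_pow_eq_zero (tailSupport F)
    (fun m => ∏ i, μ i ^ m i) (prod_pow_injective hμ hmulind).injOn
    (fun m _ => Finset.prod_ne_zero_iff.2 fun i _ => pow_ne_zero _ (hμ i)) (tailCoeff F)
    (fun n => by rw [← eval_expPoint_eq_sum_tailSupport, h n]) _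
    (Finset.mem_image_of_mem _ hd)

theorem exists_nondegenerate_expansion {μ : Fin s → K} (hμ : ∀ i, μ i ≠ 0)
    (hmulind : ∀ t : Fin s → ℤ, (∏ i, μ i ^ t i) = 1 → t = 0)
    (F : MvPolynomial (Fin (s + 1)) K) :
    ∃ (t : ℕ) (ν : Fin t → K) (R : Fin t → Polynomial K),
      Function.Injective ν ∧ (∀ i, ν i ≠ 0) ∧
      (∀ i j, i ≠ j → ∀ N : ℕ, 1 ≤ N → (ν i / ν j) ^ N ≠ 1) ∧
      ∀ n : ℕ, MvPolynomial.eval (expPoint μ n) F = ∑ i, (R i).eval (n : K) * ν i ^ n := by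
  let f := (tailSupport F).equivFin.symm
  have hf : Function.Injective fun j => (f j : Fin s →₀ ℕ) :=
    Subtype.val_injective.comp f.injective
  refine ⟨_, fun j => ∏ i, μ i ^ (f j : Fin s →₀ ℕ) i, fun j => tailCoeff F (f j),
    (prod_pow_injective hμ hmulind).comp hf,
    fun j => Finset.prod_ne_zero_iff.2 fun i _ => pow_ne_zero _ (hμ i),
    fun i j hij N hN => div_prod_pow_pow_ne_one hμ hmulind (hf.ne hij) hN, fun n => ?_⟩
  rw [eval_expPoint_eq_sum_tailSupport, ← Finset.sum_coe_sort]
  exact (f.sum_comp fun m : tailSupport F =>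
    (tailCoeff F m).eval (n : K) * (∏ i, μ i ^ (m : Fin s →₀ ℕ) i) ^ n).symm

/-- The characteristic polynomial of the recurrence satisfied by all sequences
`n ↦ F (n + 1, μ₁^n, …, μ_s^n)` with `F` of degree less than `N` in each variable. -/
def expPointCharpoly (μ : Fin s → K) (N : ℕ) : Polynomial K :=
  ∏ m : Fin s → Fin N, (Polynomial.X - Polynomial.C (∏ i, μ i ^ (m i : ℕ))) ^ N

theorem expPointCharpoly_monic (μ : Fin s → K) (N : ℕ) : (expPointCharpoly μ N).Monic :=
  Polynomial.monic_prod_of_monic _ _ fun _ _ => (Polynomial.monic_X_sub_C _).pow _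

theorem expPointCharpoly_natDegree (μ : Fin s → K) (N : ℕ) :
    (expPointCharpoly μ N).natDegree = N ^ (s + 1) := by
  rw [expPointCharpoly, Polynomial.natDegree_prod_of_monic _ _
    fun _ _ => (Polynomial.monic_X_sub_C _).pow _]
  simp_rw [Polynomial.natDegree_pow, Polynomial.natDegree_X_sub_C]
  simp [pow_succ]

theorem aeval_expPointCharpoly_eq_zero (μ : Fin s → K) {N : ℕ}
    {F : MvPolynomial (Fin (s + 1)) K} (hF : ∀ i, F.degreeOf i < N) :
    Polynomial.aeval (seqShift K) (expPointCharpoly μ N)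
      (fun n => MvPolynomial.eval (expPoint μ n) F) = 0 := by
  have hsum : (fun n => MvPolynomial.eval (expPoint μ n) F) = ∑ d ∈ F.support,
      F.coeff d • fun n : ℕ => ((n : K) + 1) ^ d 0 * (∏ i, μ i ^ d.tail i) ^ n := by
    funext n
    simp [eval_expPoint, Finset.sum_apply]
  rw [hsum, map_sum]
  refine Finset.sum_eq_zero fun d hd => ?_
  have hlt (i) : d i < N := (MvPolynomial.degreeOf_lt_iff ((Nat.zero_le _).trans_lt (hF i))).1
    (hF i) d hd
  let m : Fin s → Fin N := fun i => ⟨d.tail i, hlt i.succ⟩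
  obtain ⟨q, hq⟩ : (Polynomial.X - Polynomial.C (∏ i, μ i ^ (m i : ℕ))) ^ N ∣
      expPointCharpoly μ N :=
    Finset.dvd_prod_of_mem
      (fun m : Fin s → Fin N => (Polynomial.X - Polynomial.C (∏ i, μ i ^ (m i : ℕ))) ^ N)
      (Finset.mem_univ m)
  have hm : ∏ i, μ i ^ (m i : ℕ) = ∏ i, μ i ^ d.tail i := rfl
  rw [hm] at hq
  have hker := polynomial_mul_pow_mem_ker ((Polynomial.X + Polynomial.C 1) ^ d 0)
    (∏ i, μ i ^ d.tail i) (N := N) (by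
      rw [Polynomial.natDegree_pow, Polynomial.natDegree_X_add_C, mul_one]
      exact hlt 0)
  simp only [Polynomial.eval_pow, Polynomial.eval_add, Polynomial.eval_X,
    Polynomial.eval_C] at hker
  rw [map_smul, hq, mul_comm, map_mul, Module.End.mul_apply, map_pow, map_sub,
    Polynomial.aeval_X, Polynomial.aeval_C, Algebra.algebraMap_eq_smul_one, hker, map_zero,
    smul_zero]

theorem eval_expPoint_monomial_mul (μ : Fin s → K) (P : MvPolynomial (Fin (s + 1)) K)
    (e : Fin (s + 1) →₀ ℕ) (n : ℕ) :
    MvPolynomial.eval (expPoint μ n) (MvPolynomial.monomial e 1 * P) =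
      (∏ i, expPoint μ n i ^ e i) * MvPolynomial.eval (expPoint μ n) P := by
  rw [map_mul, MvPolynomial.eval_monomial, one_mul, Finsupp.prod_fintype _ _ (by simp)]

theorem degreeOf_monomial_mul_lt {ℓ : ℕ} (P : MvPolynomial (Fin (s + 1)) K)
    {e : Fin (s + 1) →₀ ℕ} (he : ∀ i, e i < ℓ) (i : Fin (s + 1)) :
    (MvPolynomial.monomial e 1 * P).degreeOf i < ℓ + P.totalDegree := by
  refine (MvPolynomial.degreeOf_mul_le _ _ _).trans_lt ?_
  rw [MvPolynomial.degreeOf_monomial_eq _ _ one_ne_zero]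
  exact add_lt_add_of_lt_of_le (he i) (MvPolynomial.degreeOf_le_totalDegree _ _)

/-- The polynomials `x^e * P`, for distinct exponents `e`, are linearly independent. -/
theorem eq_zero_of_sum_smul_monomial_mul_eq_zero {ι : Type*} [Fintype ι]
    {P : MvPolynomial (Fin (s + 1)) K} (hP : P ≠ 0) {E : ι → Fin (s + 1) →₀ ℕ}
    (hE : Function.Injective E) (b : ι → K)
    (h : ∑ e, b e • (MvPolynomial.monomial (E e) 1 * P) = 0) : b = 0 := by
  classical
  simp_rw [← smul_mul_assoc, ← Finset.sum_mul] at h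
  funext e
  have := congrArg (MvPolynomial.coeff (E e)) ((mul_eq_zero.1 h).resolve_right hP)
  simpa [MvPolynomial.coeff_sum, MvPolynomial.coeff_monomial, hE.eq_iff] using this

end ExpPoint

theorem add_pow_succ_le {ℓ : ℕ} (hℓ : 1 ≤ ℓ) (d s : ℕ) :
    (ℓ + d) ^ (s + 1) ≤ ℓ ^ (s + 1) + (d + 1) ^ (s + 1) * ℓ ^ s := by
  have hle : ℓ + d ≤ (d + 1) * ℓ := by nlinarith
  induction s with
  | zero => simp
  | succ s ih =>
    calc (ℓ + d) ^ (s + 1 + 1) = ℓ * (ℓ + d) ^ (s + 1) + d * (ℓ + d) ^ (s + 1) := by ring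
      _ ≤ ℓ * (ℓ ^ (s + 1) + (d + 1) ^ (s + 1) * ℓ ^ s) + d * ((d + 1) * ℓ) ^ (s + 1) := by
        gcongr
      _ = ℓ ^ (s + 1 + 1) + (d + 1) ^ (s + 1 + 1) * ℓ ^ (s + 1) := by rw [mul_pow]; ring

/-- Let `μ₁, …, μ_s` be nonzero multiplicatively independent algebraic
numbers and `P` a nonzero polynomial in `s + 1` variables.  There is `B : ℕ` such that for
every `ℓ ≥ 1`, the `ℓ^(s+1)` sequences
`w e n = Q_e(n+1, μ₁^n, …, μ_s^n) · P(n+1, μ₁^n, …, μ_s^n)` — where `Q_e` ranges over the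
monomials with all exponents `< ℓ` — are linearly independent, satisfy a common linear
recurrence of order at most `ℓ^(s+1) + B ℓ^s`, are non-degenerate LRS, and their common zero
set is exactly the zero set of `n ↦ P(n+1, μ₁^n, …, μ_s^n)`. -/
theorem simskolem_family (s : ℕ) (μ : Fin s → Qbar) (hμ : ∀ i, μ i ≠ 0)
    (hmulind : ∀ t : Fin s → ℤ, (∏ i, μ i ^ t i) = 1 → t = 0)
    (P : MvPolynomial (Fin (s + 1)) Qbar) (hP : P ≠ 0) :
    ∃ B : ℕ, ∀ ℓ : ℕ, 1 ≤ ℓ →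
      ∀ w : (Fin (s + 1) → Fin ℓ) → ℕ → Qbar,
        (∀ e n, w e n =
            (∏ i : Fin (s + 1),
              (Fin.cons ((n : Qbar) + 1) (fun i' : Fin s => μ i' ^ n) i) ^ ((e i : ℕ))) *
            MvPolynomial.eval (Fin.cons ((n : Qbar) + 1) (fun i' : Fin s => μ i' ^ n)) P) →
        ((∀ b : (Fin (s + 1) → Fin ℓ) → Qbar,
            (∀ n : ℕ, ∑ e, b e * w e n = 0) → b = 0) ∧
          (∃ (D : ℕ) (a : Fin D → Qbar), D ≤ ℓ ^ (s + 1) + B * ℓ ^ s ∧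
            ∀ e, ∀ n : ℕ, w e (n + D) = ∑ i : Fin D, a i * w e (n + D - 1 - (i : ℕ))) ∧
          (∀ e, ∃ (t : ℕ) (ν : Fin t → Qbar) (R : Fin t → Polynomial Qbar),
            Function.Injective ν ∧ (∀ i, ν i ≠ 0) ∧
            (∀ i j, i ≠ j → ∀ nn : ℕ, 1 ≤ nn → (ν i / ν j) ^ nn ≠ 1) ∧
            ∀ n : ℕ, w e n = ∑ i, (R i).eval ((n : Qbar)) * ν i ^ n) ∧
          ({n : ℕ | ∀ e, w e n = 0} =
            {n : ℕ | MvPolynomial.eval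
              (Fin.cons ((n : Qbar) + 1) (fun i' : Fin s => μ i' ^ n)) P = 0})) := by
  refine ⟨(P.totalDegree + 1) ^ (s + 1), fun ℓ hℓ w hw => ?_⟩
  let E (e : Fin (s + 1) → Fin ℓ) : Fin (s + 1) →₀ ℕ :=
    Finsupp.equivFunOnFinite.symm fun i => (e i : ℕ)
  have hE : Function.Injective E := fun e e' h => funext fun i =>
    Fin.ext (DFunLike.congr_fun h i)
  have hwE (e n) : w e n =
      MvPolynomial.eval (expPoint μ n) (MvPolynomial.monomial (E e) 1 * P) :=
    (hw e n).trans (eval_expPoint_monomial_mul μ P (E e) n).symm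
  refine ⟨fun b hb => ?_, ?_, fun e => ?_, ?_⟩
  · refine eq_zero_of_sum_smul_monomial_mul_eq_zero hP hE b
      (eq_zero_of_forall_eval_expPoint_eq_zero hμ hmulind fun n => ?_)
    rw [map_sum, ← hb n]
    exact Finset.sum_congr rfl fun e _ => by rw [MvPolynomial.smul_eval, hwE]
  · refine ⟨_, _, ?_, fun e n => recurrence_of_aeval_seqShift_eq_zero
      (expPointCharpoly_monic μ (ℓ + P.totalDegree)) ?_ n⟩
    · rw [expPointCharpoly_natDegree]
      exact add_pow_succ_le hℓ _ _
    · rw [show w e = _ from funext (hwE e)]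
      exact aeval_expPointCharpoly_eq_zero μ
        (degreeOf_monomial_mul_lt P fun i => (e i).isLt)
  · simp_rw [hwE]
    exact exists_nondegenerate_expansion hμ hmulind _
  · ext n
    refine ⟨fun h => ?_, fun h e => ?_⟩
    · simpa [hw] using h fun _ => ⟨0, hℓ⟩
    · rw [hw, show MvPolynomial.eval _ P = 0 from h, mul_zero]

end
end
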